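/- Let μ = (μ(t); 0 ≤ t ≤ 1) be a path in the space of permutons from the identity permuton to the reverse permuton whose energy in the 2-Wasserstein metric equals π²/6. Then μ(t) = A(t) for every t, where A is the Archimedean path, i.e. A(t) is the law of (𝒜(0), 𝒜(t)) with 𝒜 the Archimedean process. -/

import Mathlib

open MeasureTheory Set Filter
open scoped ENNReal Real Topology

/-- The uniform probability measure on [-1,1]. -/
noncomputable def unif : Measure ℝ := (2 : ℝ≥0∞)⁻¹ • (volume.restrict (Icc (-1 : ℝ) 1))

/-- `t 0 = 0 < t 1 < ... < t k = 1` is a finite partition of [0,1]. -/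
def IsPartition (k : ℕ) (t : ℕ → ℝ) : Prop :=
  0 < k ∧ t 0 = 0 ∧ t k = 1 ∧ ∀ i < k, t i < t (i + 1)

/-- The energy of a path along partitions of [0,1], expressed in terms of the
squared-distance function `D s t` between the points `γ s` and `γ t` of the path:
`E = sup_Π Σ_i d(γ(t_i),γ(t_{i-1}))² / (t_i - t_{i-1})`. -/
noncomputable def energyOf (D : ℝ → ℝ → ℝ) : ℝ≥0∞ :=
  ⨆ (k : ℕ) (t : ℕ → ℝ) (_ : IsPartition k t),
    ENNReal.ofReal (∑ i ∈ Finset.range k, D (t i) (t (i + 1)) / (t (i + 1) - t i))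

/-- Optimal transportation cost between two measures for the cost `c`. -/
noncomputable def W2sqCost {K : Type*} [MeasurableSpace K] (c : K × K → ℝ)
    (μ ν : Measure K) : ℝ :=
  sInf {e | ∃ m : Measure (K × K), IsProbabilityMeasure m ∧
    m.map Prod.fst = μ ∧ m.map Prod.snd = ν ∧ e = ∫ p, c p ∂m}

/-- The squared 2-Wasserstein distance between measures on the plane,
with the Euclidean metric: `W₂(μ,ν)² = inf over couplings of E[‖V-W‖²]`. -/
noncomputable def W2sqE (μ ν : Measure (ℝ × ℝ)) : ℝ :=
  W2sqCost (fun p => (p.1.1 - p.2.1) ^ 2 + (p.1.2 - p.2.2) ^ 2) μ ν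

/-- A permuton: a Borel probability measure on the plane whose coordinate marginals
are uniform on [-1,1]. -/
def IsPermuton (μ : Measure (ℝ × ℝ)) : Prop :=
  IsProbabilityMeasure μ ∧ μ.map Prod.fst = unif ∧ μ.map Prod.snd = unif

/-- The identity permuton, the law of (X, X) with X ~ Uniform[-1,1]. -/
noncomputable def idPermuton : Measure (ℝ × ℝ) := unif.map (fun x => (x, x))

/-- The reverse permuton, the law of (X, -X) with X ~ Uniform[-1,1]. -/
noncomputable def revPermuton : Measure (ℝ × ℝ) := unif.map (fun x => (x, -x))

/-- The Archimedean measure, with density (2π√(1-x²-y²))⁻¹ on the unit disk. -/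
noncomputable def archMeasure : Measure (ℝ × ℝ) :=
  volume.withDensity fun p =>
    ENNReal.ofReal
      (if p.1 ^ 2 + p.2 ^ 2 < 1 then (2 * π * Real.sqrt (1 - p.1 ^ 2 - p.2 ^ 2))⁻¹ else 0)

/-- The Archimedean path: `archPath t` is the law of (𝒜(0), 𝒜(t)) where
𝒜(t) = cos(πt)·Aₓ + sin(πt)·A_y with (Aₓ, A_y) distributed as the Archimedean measure. -/
noncomputable def archPath (t : ℝ) : Measure (ℝ × ℝ) :=
  archMeasure.map fun p => (p.1, Real.cos (π * t) * p.1 + Real.sin (π * t) * p.2)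

/-- Squared Euclidean distance in the plane. -/
def sqDist (v w : ℝ × ℝ) : ℝ := (v.1 - w.1) ^ 2 + (v.2 - w.2) ^ 2

/-- The least action of a planar harmonic oscillator of unit frequency which goes from `v` to `w`
in time `p`. -/
noncomputable def oscAction (p : ℝ) (v w : ℝ × ℝ) : ℝ :=
  (sqDist v w - (1 - Real.cos p) * (v.1 ^ 2 + v.2 ^ 2 + w.1 ^ 2 + w.2 ^ 2)) / Real.sin p

/-- The position at time `p` of the oscillator trajectory from `v` to `w` in time `p + q`. -/
noncomputable def oscInterp (p q : ℝ) (v w : ℝ × ℝ) : ℝ × ℝ :=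
  ((Real.sin q * v.1 + Real.sin p * w.1) / Real.sin (p + q),
    (Real.sin q * v.2 + Real.sin p * w.2) / Real.sin (p + q))

lemma sqDist_nonneg (v w : ℝ × ℝ) : 0 ≤ sqDist v w := by unfold sqDist; positivity

lemma sin_pos_of_pos_of_le_pi_div_two {p : ℝ} (hp : 0 < p) (h : p ≤ π / 2) : 0 < Real.sin p :=
  Real.sin_pos_of_pos_of_lt_pi hp (by linarith [Real.pi_pos])

lemma oscAction_add {p q : ℝ} (hp : 0 < p) (hq : 0 < q) (hpq : p + q ≤ π / 2)
    (x y z : ℝ × ℝ) :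
    oscAction p x y + oscAction q y z = oscAction (p + q) x z +
      Real.sin (p + q) / (Real.sin p * Real.sin q) * sqDist y (oscInterp p q x z) := by
  have scalar (x y z : ℝ) : ((x ^ 2 + y ^ 2) * Real.cos p - 2 * x * y) / Real.sin p +
      ((y ^ 2 + z ^ 2) * Real.cos q - 2 * y * z) / Real.sin q =
      ((x ^ 2 + z ^ 2) * Real.cos (p + q) - 2 * x * z) / Real.sin (p + q) +
        Real.sin (p + q) / (Real.sin p * Real.sin q) *
          (y - (Real.sin q * x + Real.sin p * z) / Real.sin (p + q)) ^ 2 := by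
    have h1 : Real.sin p ≠ 0 := (sin_pos_of_pos_of_le_pi_div_two hp (by linarith)).ne'
    have h2 : Real.sin q ≠ 0 := (sin_pos_of_pos_of_le_pi_div_two hq (by linarith)).ne'
    have h3 : Real.sin (p + q) ≠ 0 :=
      (sin_pos_of_pos_of_le_pi_div_two (by linarith) hpq).ne'
    have e1 : Real.cos p ^ 2 = 1 - Real.sin p ^ 2 := Real.cos_sq' p
    have e2 : Real.cos q ^ 2 = 1 - Real.sin q ^ 2 := Real.cos_sq' q
    field_simp
    rw [Real.sin_add, Real.cos_add]
    ring_nf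
    simp only [e1, e2]
    ring
  have split (r : ℝ) (v w : ℝ × ℝ) : oscAction r v w =
      ((v.1 ^ 2 + w.1 ^ 2) * Real.cos r - 2 * v.1 * w.1) / Real.sin r +
        ((v.2 ^ 2 + w.2 ^ 2) * Real.cos r - 2 * v.2 * w.2) / Real.sin r := by
    unfold oscAction sqDist
    ring
  rw [split, split, split]
  simp only [sqDist, oscInterp]
  linear_combination scalar x.1 y.1 z.1 + scalar x.2 y.2 z.2

lemma oscAction_subadd {p q : ℝ} (hp : 0 < p) (hq : 0 < q) (hpq : p + q ≤ π / 2)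
    (x y z : ℝ × ℝ) : oscAction (p + q) x z ≤ oscAction p x y + oscAction q y z := by
  rw [oscAction_add hp hq hpq]
  have h1 := sin_pos_of_pos_of_le_pi_div_two hp (by linarith)
  have h2 := sin_pos_of_pos_of_le_pi_div_two hq (by linarith)
  have h3 := sin_pos_of_pos_of_le_pi_div_two (add_pos hp hq) hpq
  have h4 := sqDist_nonneg y (oscInterp p q x z)
  have : 0 ≤ Real.sin (p + q) / (Real.sin p * Real.sin q) * sqDist y (oscInterp p q x z) := by
    positivity
  linarith

/-- Gluing of two couplings along a common marginal. -/
lemma exists_glue {α β γ : Type*} [MeasurableSpace α] [MeasurableSpace β] [MeasurableSpace γ]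
    [StandardBorelSpace γ] [Nonempty γ] (m₁ : Measure (α × β)) (m₂ : Measure (β × γ))
    [IsProbabilityMeasure m₁] [IsProbabilityMeasure m₂]
    (h : m₁.map Prod.snd = m₂.map Prod.fst) :
    ∃ m : Measure ((α × β) × γ), IsProbabilityMeasure m ∧ m.map Prod.fst = m₁ ∧
      m.map (fun p => (p.1.2, p.2)) = m₂ := by
  refine ⟨m₁.compProd (m₂.condKernel.comap Prod.snd measurable_snd), inferInstance, ?_, ?_⟩
  · exact Measure.fst_compProd _ _
  · ext s hs
    rw [Measure.map_apply (by fun_prop) hs, Measure.compProd_apply (hs.preimage (by fun_prop))]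
    conv_rhs => rw [← m₂.disintegrate m₂.condKernel, Measure.compProd_apply hs, Measure.fst, ← h]
    rw [lintegral_map (ProbabilityTheory.Kernel.measurable_kernel_prodMk_left hs) measurable_snd]
    rfl

instance : IsProbabilityMeasure unif := by
  constructor
  simp only [unif, Measure.smul_apply, MeasurableSet.univ, Measure.restrict_apply, univ_inter,
    Real.volume_Icc, smul_eq_mul]
  norm_num
  exact ENNReal.inv_mul_cancel (by norm_num) (by norm_num)

lemma unif_ae_abs_le_one : ∀ᵐ x ∂unif, |x| ≤ 1 := by
  refine Measure.ae_smul_measure ?_ _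
  filter_upwards [ae_restrict_mem measurableSet_Icc] with x hx
  exact abs_le.2 hx

lemma integral_sq_unif : ∫ x, x ^ 2 ∂unif = 1 / 3 := by
  rw [unif, integral_smul_measure, integral_Icc_eq_integral_Ioc,
    ← intervalIntegral.integral_of_le (by norm_num), integral_pow]
  norm_num

section RandomVariables

variable {Ω : Type*} [MeasurableSpace Ω] {ρ : Measure Ω}

lemma ae_abs_le_one_of_map_eq_unif {X : Ω → ℝ} (hX : Measurable X) (h : ρ.map X = unif) :
    ∀ᵐ ω ∂ρ, |X ω| ≤ 1 :=
  ae_of_ae_map hX.aemeasurable (h ▸ unif_ae_abs_le_one)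

lemma integral_sq_of_map_eq_unif {X : Ω → ℝ} (hX : Measurable X) (h : ρ.map X = unif) :
    ∫ ω, X ω ^ 2 ∂ρ = 1 / 3 := by
  rw [← integral_sq_unif, ← h, integral_map hX.aemeasurable (by fun_prop)]

/-- A random point of the plane whose law is a permuton. -/
structure IsPermRV (V : Ω → ℝ × ℝ) (ρ : Measure Ω) : Prop where
  measurable : Measurable V
  map_fst : ρ.map (fun ω => (V ω).1) = unif
  map_snd : ρ.map (fun ω => (V ω).2) = unif

lemma IsPermRV.of_map {V : Ω → ℝ × ℝ} (hV : Measurable V) (h : IsPermuton (ρ.map V)) :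
    IsPermRV V ρ := by
  obtain ⟨-, h1, h2⟩ := h
  rw [Measure.map_map (by fun_prop) hV] at h1 h2
  exact ⟨hV, h1, h2⟩

variable {V W : Ω → ℝ × ℝ}

lemma IsPermRV.integrable_sq_add_sq (hV : IsPermRV V ρ) [IsFiniteMeasure ρ] :
    Integrable (fun ω => (V ω).1 ^ 2 + (V ω).2 ^ 2) ρ := by
  have hm := hV.measurable
  refine Integrable.of_bound (by fun_prop) 2 ?_
  filter_upwards [ae_abs_le_one_of_map_eq_unif (by fun_prop) hV.map_fst,
    ae_abs_le_one_of_map_eq_unif (by fun_prop) hV.map_snd] with ω h1 h2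
  rw [Real.norm_of_nonneg (by positivity)]
  linarith [(sq_le_one_iff_abs_le_one _).2 h1, (sq_le_one_iff_abs_le_one _).2 h2]

lemma IsPermRV.integral_sq_add_sq (hV : IsPermRV V ρ) [IsFiniteMeasure ρ] :
    ∫ ω, ((V ω).1 ^ 2 + (V ω).2 ^ 2) ∂ρ = 2 / 3 := by
  have hm := hV.measurable
  have bd {X : Ω → ℝ} (hX : Measurable X) (h : ρ.map X = unif) :
      Integrable (fun ω => X ω ^ 2) ρ := by
    refine Integrable.of_bound (by fun_prop) 1 ?_
    filter_upwards [ae_abs_le_one_of_map_eq_unif hX h] with ω h1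
    rw [Real.norm_of_nonneg (by positivity)]
    exact (sq_le_one_iff_abs_le_one _).2 h1
  rw [integral_add (bd (by fun_prop) hV.map_fst) (bd (by fun_prop) hV.map_snd),
    integral_sq_of_map_eq_unif (by fun_prop) hV.map_fst,
    integral_sq_of_map_eq_unif (by fun_prop) hV.map_snd]
  norm_num

lemma measurable_sqDist : Measurable (fun p : (ℝ × ℝ) × ℝ × ℝ => sqDist p.1 p.2) := by
  unfold sqDist
  fun_prop

lemma IsPermRV.integrable_sqDist (hV : IsPermRV V ρ) (hW : IsPermRV W ρ) [IsFiniteMeasure ρ] :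
    Integrable (fun ω => sqDist (V ω) (W ω)) ρ := by
  have hm := measurable_sqDist.comp (hV.measurable.prodMk hW.measurable)
  refine ((hV.integrable_sq_add_sq.add hW.integrable_sq_add_sq).const_mul 2).mono'
    hm.aestronglyMeasurable (ae_of_all _ fun ω => ?_)
  rw [Real.norm_of_nonneg (sqDist_nonneg _ _)]
  simp only [sqDist, Pi.add_apply]
  nlinarith [sq_nonneg ((V ω).1 + (W ω).1), sq_nonneg ((V ω).2 + (W ω).2)]

/-- The mean oscillator action over time `p` of a pair of permuton-distributed points whose mean
squared distance is `e`. -/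
noncomputable def meanAction (p e : ℝ) : ℝ := (e - 4 / 3 * (1 - Real.cos p)) / Real.sin p

lemma IsPermRV.integrable_oscAction (hV : IsPermRV V ρ) (hW : IsPermRV W ρ) [IsFiniteMeasure ρ]
    (p : ℝ) : Integrable (fun ω => oscAction p (V ω) (W ω)) ρ := by
  have h := ((hV.integrable_sqDist hW).sub ((hV.integrable_sq_add_sq.add
    hW.integrable_sq_add_sq).const_mul (1 - Real.cos p))).div_const (Real.sin p)
  refine h.congr (ae_of_all _ fun ω => ?_)
  simp only [oscAction, Pi.sub_apply, Pi.add_apply]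
  ring

lemma IsPermRV.integral_oscAction (hV : IsPermRV V ρ) (hW : IsPermRV W ρ) [IsFiniteMeasure ρ]
    (p : ℝ) : ∫ ω, oscAction p (V ω) (W ω) ∂ρ = meanAction p (∫ ω, sqDist (V ω) (W ω) ∂ρ) := by
  have h : ∀ ω, oscAction p (V ω) (W ω) = (sqDist (V ω) (W ω) - (1 - Real.cos p) *
      (((V ω).1 ^ 2 + (V ω).2 ^ 2) + ((W ω).1 ^ 2 + (W ω).2 ^ 2))) / Real.sin p := by
    intro ω
    simp only [oscAction]
    ring
  have hi : Integrable (fun ω => (1 - Real.cos p) *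
      (((V ω).1 ^ 2 + (V ω).2 ^ 2) + ((W ω).1 ^ 2 + (W ω).2 ^ 2))) ρ :=
    (hV.integrable_sq_add_sq.add hW.integrable_sq_add_sq).const_mul _
  simp_rw [h]
  rw [integral_div, integral_sub (hV.integrable_sqDist hW) hi, integral_const_mul,
    integral_add hV.integrable_sq_add_sq hW.integrable_sq_add_sq, hV.integral_sq_add_sq,
    hW.integral_sq_add_sq, meanAction]
  ring

end RandomVariables

lemma W2sqE_eq_sInf (μ ν : Measure (ℝ × ℝ)) : W2sqE μ ν =
    sInf {e | ∃ m : Measure ((ℝ × ℝ) × ℝ × ℝ), IsProbabilityMeasure m ∧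
      m.map Prod.fst = μ ∧ m.map Prod.snd = ν ∧ e = ∫ p, sqDist p.1 p.2 ∂m} := rfl

lemma W2sqE_nonneg (μ ν : Measure (ℝ × ℝ)) : 0 ≤ W2sqE μ ν := by
  rw [W2sqE_eq_sInf]
  refine Real.sInf_nonneg ?_
  rintro e ⟨m, -, -, -, rfl⟩
  exact integral_nonneg fun p => sqDist_nonneg _ _

lemma W2sqE_le_integral {Ω : Type*} [MeasurableSpace Ω] {ρ : Measure Ω} [IsProbabilityMeasure ρ]
    {V W : Ω → ℝ × ℝ} (hV : Measurable V) (hW : Measurable W) :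
    W2sqE (ρ.map V) (ρ.map W) ≤ ∫ ω, sqDist (V ω) (W ω) ∂ρ := by
  rw [W2sqE_eq_sInf]
  refine csInf_le ⟨0, ?_⟩ ⟨ρ.map fun ω => (V ω, W ω), ?_, ?_, ?_, ?_⟩
  · rintro e ⟨m, -, -, -, rfl⟩
    exact integral_nonneg fun p => sqDist_nonneg _ _
  · exact Measure.isProbabilityMeasure_map (by fun_prop)
  · rw [Measure.map_map (by fun_prop) (by fun_prop)]; rfl
  · rw [Measure.map_map (by fun_prop) (by fun_prop)]; rfl
  · rw [integral_map (by fun_prop) measurable_sqDist.aestronglyMeasurable]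

lemma meanAction_mono {p : ℝ} (hp : 0 < p) (h : p ≤ π / 2) {e e' : ℝ} (he : e ≤ e') :
    meanAction p e ≤ meanAction p e' := by
  have := sin_pos_of_pos_of_le_pi_div_two hp h
  unfold meanAction
  gcongr

lemma exists_coupling_meanAction_le {μ ν : Measure (ℝ × ℝ)} (hμ : IsPermuton μ)
    (hν : IsPermuton ν) {p : ℝ} (hp : 0 < p) (h : p ≤ π / 2) {ε : ℝ} (hε : 0 < ε) :
    ∃ m : Measure ((ℝ × ℝ) × ℝ × ℝ), IsProbabilityMeasure m ∧
      m.map Prod.fst = μ ∧ m.map Prod.snd = ν ∧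
      meanAction p (∫ x, sqDist x.1 x.2 ∂m) ≤ meanAction p (W2sqE μ ν) + ε := by
  have hs := sin_pos_of_pos_of_le_pi_div_two hp h
  have := hμ.1
  have := hν.1
  have hne : {e | ∃ m : Measure ((ℝ × ℝ) × ℝ × ℝ), IsProbabilityMeasure m ∧
      m.map Prod.fst = μ ∧ m.map Prod.snd = ν ∧ e = ∫ p, sqDist p.1 p.2 ∂m}.Nonempty :=
    ⟨_, μ.prod ν, inferInstance, by simp, by simp, rfl⟩
  obtain ⟨e, ⟨m, hm, h1, h2, rfl⟩, he⟩ := exists_lt_of_csInf_lt hne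
    (lt_add_of_pos_right _ (mul_pos hε hs))
  rw [← W2sqE_eq_sInf] at he
  refine ⟨m, hm, h1, h2, ?_⟩
  unfold meanAction
  rw [div_add' _ _ _ hs.ne']
  gcongr
  linarith

lemma meanAction_W2sqE_subadd {μ ν κ : Measure (ℝ × ℝ)} (hμ : IsPermuton μ) (hν : IsPermuton ν)
    (hκ : IsPermuton κ) {p q : ℝ} (hp : 0 < p) (hq : 0 < q) (hpq : p + q ≤ π / 2) :
    meanAction (p + q) (W2sqE μ κ) ≤ meanAction p (W2sqE μ ν) + meanAction q (W2sqE ν κ) := by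
  refine le_of_forall_pos_le_add fun ε hε => ?_
  obtain ⟨m₁, _, h1, h2, hm₁⟩ :=
    exists_coupling_meanAction_le hμ hν hp (by linarith) (half_pos hε)
  obtain ⟨m₂, _, h3, h4, hm₂⟩ :=
    exists_coupling_meanAction_le hν hκ hq (by linarith) (half_pos hε)
  obtain ⟨m, _, h5, h6⟩ := exists_glue m₁ m₂ (h2.trans h3.symm)
  have l1 : m.map (fun ω => ω.1.1) = μ := by
    rw [← h1, ← h5, Measure.map_map (by fun_prop) (by fun_prop)]; rfl
  have l2 : m.map (fun ω => ω.1.2) = ν := by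
    rw [← h2, ← h5, Measure.map_map (by fun_prop) (by fun_prop)]; rfl
  have l3 : m.map (fun ω => ω.2) = κ := by
    rw [← h4, ← h6, Measure.map_map (by fun_prop) (by fun_prop)]; rfl
  have r1 : IsPermRV (fun ω : ((ℝ × ℝ) × ℝ × ℝ) × ℝ × ℝ => ω.1.1) m :=
    .of_map (by fun_prop) (l1 ▸ hμ)
  have r2 : IsPermRV (fun ω : ((ℝ × ℝ) × ℝ × ℝ) × ℝ × ℝ => ω.1.2) m :=
    .of_map (by fun_prop) (l2 ▸ hν)
  have r3 : IsPermRV (fun ω : ((ℝ × ℝ) × ℝ × ℝ) × ℝ × ℝ => ω.2) m :=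
    .of_map (by fun_prop) (l3 ▸ hκ)
  rw [← h5, integral_map (by fun_prop) measurable_sqDist.aestronglyMeasurable,
    ← r1.integral_oscAction r2] at hm₁
  rw [← h6, integral_map (by fun_prop) measurable_sqDist.aestronglyMeasurable,
    ← r2.integral_oscAction r3] at hm₂
  have hle : W2sqE μ κ ≤ ∫ ω, sqDist ω.1.1 ω.2 ∂m := by
    conv_lhs => rw [← l1, ← l3]
    exact W2sqE_le_integral (by fun_prop) (by fun_prop)
  have key := integral_mono (r1.integrable_oscAction r3 (p + q))
    ((r1.integrable_oscAction r2 p).add (r2.integrable_oscAction r3 q))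
    fun ω => oscAction_subadd hp hq hpq ω.1.1 ω.1.2 ω.2
  simp only [Pi.add_apply] at key
  rw [integral_add (r1.integrable_oscAction r2 p) (r2.integrable_oscAction r3 q),
    r1.integral_oscAction r3] at key
  linarith [meanAction_mono (add_pos hp hq) hpq hle]

/-- `S` is the energy sum of the squared-distance function `D` along some partition of `[a, b]` of
mesh at most `h`. -/
def IsEnergySum (D : ℝ → ℝ → ℝ) (h a b S : ℝ) : Prop :=
  ∃ (k : ℕ) (t : ℕ → ℝ), 0 < k ∧ t 0 = a ∧ t k = b ∧
    (∀ i < k, t i < t (i + 1) ∧ t (i + 1) - t i ≤ h) ∧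
    S = ∑ i ∈ Finset.range k, D (t i) (t (i + 1)) / (t (i + 1) - t i)

lemma IsEnergySum.trans {D : ℝ → ℝ → ℝ} {h a b c S T : ℝ} (h₁ : IsEnergySum D h a b S)
    (h₂ : IsEnergySum D h b c T) : IsEnergySum D h a c (S + T) := by
  obtain ⟨k, t, hk, t0, tk, ht, rfl⟩ := h₁
  obtain ⟨l, u, hl, u0, ul, hu, rfl⟩ := h₂
  have e1 : ∀ i ≤ k, (if i ≤ k then t i else u (i - k)) = t i := fun i hi => if_pos hi
  have e2 : ∀ i, (if k + i ≤ k then t (k + i) else u (k + i - k)) = u i := by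
    intro i
    split_ifs with hi
    · obtain rfl : i = 0 := by omega
      simp [tk, u0]
    · congr 1
      omega
  refine ⟨k + l, fun i => if i ≤ k then t i else u (i - k), by omega, by simp [t0], ?_, ?_, ?_⟩
  · exact (e2 l).trans ul
  · intro i hi
    rcases lt_or_ge i k with hik | hik
    · simp only [e1 i hik.le, e1 (i + 1) hik]
      exact ht i hik
    · obtain ⟨j, rfl⟩ := Nat.exists_eq_add_of_le hik
      simp only [add_assoc, e2]
      exact hu j (by omega)
  · rw [Finset.sum_range_add]
    congr 1
    · refine Finset.sum_congr rfl fun i hi => ?_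
      have hik := Finset.mem_range.1 hi
      simp only [e1 i hik.le, e1 (i + 1) hik]
    · refine Finset.sum_congr rfl fun i _ => ?_
      simp only [add_assoc, e2]

lemma exists_isEnergySum (D : ℝ → ℝ → ℝ) {h a b : ℝ} (hh : 0 < h) (hab : a < b) :
    ∃ S, IsEnergySum D h a b S := by
  obtain ⟨n, hn⟩ := exists_nat_gt ((b - a) / h)
  have hn0 : (0 : ℝ) < n := (div_pos (sub_pos.2 hab) hh).trans hn
  refine ⟨_, n, fun i => a + i * ((b - a) / n), by exact_mod_cast hn0, by simp, ?_, ?_, rfl⟩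
  · field_simp
    ring
  · intro i _
    have h1 : 0 < (b - a) / n := div_pos (sub_pos.2 hab) hn0
    have h2 : (b - a) / n ≤ h := by
      rw [div_le_iff₀ hn0]
      rw [div_lt_iff₀ hh] at hn
      linarith
    push_cast
    constructor <;> nlinarith

lemma IsEnergySum.subadd_le {c D : ℝ → ℝ → ℝ} {M κ h : ℝ}
    (hsub : ∀ x y z, 0 ≤ x → x < y → y < z → z ≤ 1 → c x z ≤ c x y + c y z)
    (hloc : ∀ x y, 0 ≤ x → x < y → y ≤ 1 → y - x ≤ h →
      c x y ≤ M * (D x y / (y - x)) - κ * (y - x))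
    {a b S : ℝ} (hS : IsEnergySum D h a b S) (ha : 0 ≤ a) (hb : b ≤ 1) :
    c a b ≤ M * S - κ * (b - a) := by
  obtain ⟨k, t, hk, rfl, rfl, ht, rfl⟩ := hS
  have main : t 0 < t k ∧ c (t 0) (t k) ≤
      M * (∑ i ∈ Finset.range k, D (t i) (t (i + 1)) / (t (i + 1) - t i)) -
        κ * (t k - t 0) := by
    induction k, (show 1 ≤ k from hk) using Nat.le_induction with
    | base =>
      obtain ⟨h1, h2⟩ := ht 0 one_pos
      simpa using ⟨h1, hloc _ _ ha h1 hb h2⟩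
    | succ n hn ih =>
      obtain ⟨h1, h2⟩ := ht n n.lt_succ_self
      obtain ⟨h3, h4⟩ := ih hn (h1.le.trans hb) fun i hi => ht i (hi.trans n.lt_succ_self)
      refine ⟨h3.trans h1, ?_⟩
      rw [Finset.sum_range_succ]
      linarith [hsub _ _ _ ha h3 h1 hb, hloc _ _ (ha.trans h3.le) h1 hb h2]
  exact main.2

lemma half_mul_sin_le_one_sub_cos {p : ℝ} (hp : 0 < p) (h : p ≤ π / 2) :
    p / 2 * Real.sin p ≤ 1 - Real.cos p := by
  have h1 := Real.le_tan (x := p / 2) (by linarith) (by linarith [Real.pi_pos])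
  have hc : 0 < Real.cos (p / 2) := Real.cos_pos_of_mem_Ioo ⟨by linarith, by linarith [Real.pi_pos]⟩
  have hs : 0 < Real.sin (p / 2) := sin_pos_of_pos_of_le_pi_div_two (by linarith) (by linarith)
  rw [Real.tan_eq_sin_div_cos, le_div_iff₀ hc] at h1
  have e1 : Real.sin p = 2 * Real.sin (p / 2) * Real.cos (p / 2) := by
    rw [← Real.sin_two_mul]; ring_nf
  have e2 : Real.cos p = 1 - 2 * Real.sin (p / 2) ^ 2 := by
    have := Real.cos_two_mul' (p / 2)
    rw [show 2 * (p / 2) = p by ring] at this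
    rw [this, Real.cos_sq']
    ring
  rw [e1, e2]
  nlinarith

lemma meanAction_le_of_le {Δ h e : ℝ} (hΔ : 0 < Δ) (hΔh : Δ ≤ h) (hh : h < 1) (he : 0 ≤ e) :
    meanAction (π / 2 * Δ) e ≤ 2 / (π * (1 - h ^ 2)) * (e / Δ) - π / 3 * Δ := by
  have hπ := Real.pi_pos
  have hp : 0 < π / 2 * Δ := by positivity
  have hp' : π / 2 * Δ ≤ π / 2 := by nlinarith
  have hs := sin_pos_of_pos_of_le_pi_div_two hp hp'
  have hh2 : 0 < 1 - h ^ 2 := by nlinarith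
  have h1 : π / 2 * Δ * (1 - h ^ 2) ≤ Real.sin (π / 2 * Δ) := by
    refine le_trans ?_ (Real.sin_gt_sub_cube hp).le
    have : (π / 2 * Δ) ^ 2 / 6 ≤ h ^ 2 := by
      have : π ^ 2 ≤ 16 := by nlinarith [Real.pi_le_four]
      nlinarith [sq_nonneg Δ]
    nlinarith
  have h2 := half_mul_sin_le_one_sub_cos hp hp'
  have h3 : π / 3 * Δ ≤ 4 / 3 * (1 - Real.cos (π / 2 * Δ)) / Real.sin (π / 2 * Δ) := by
    rw [le_div_iff₀ hs]
    linarith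
  have h4 : e / Real.sin (π / 2 * Δ) ≤ 2 / (π * (1 - h ^ 2)) * (e / Δ) := by
    calc e / Real.sin (π / 2 * Δ) ≤ e / (π / 2 * Δ * (1 - h ^ 2)) := by gcongr
      _ = _ := by field_simp
  rw [meanAction, sub_div]
  linarith

lemma sum_meanAction_nonpos {μ : ℝ → Measure (ℝ × ℝ)}
    (hperm : ∀ t ∈ Icc (0 : ℝ) 1, IsPermuton (μ t))
    (henergy : energyOf (fun s t => W2sqE (μ s) (μ t)) ≤ ENNReal.ofReal (π ^ 2 / 6))
    {s t : ℝ} (hs : 0 < s) (hst : s < t) (ht : t < 1) :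
    meanAction (π / 2 * s) (W2sqE (μ 0) (μ s)) +
      meanAction (π / 2 * (t - s)) (W2sqE (μ s) (μ t)) +
      meanAction (π / 2 * (1 - t)) (W2sqE (μ t) (μ 1)) ≤ 0 := by
  have hπ := Real.pi_pos
  set D : ℝ → ℝ → ℝ := fun s t => W2sqE (μ s) (μ t) with hD
  set c : ℝ → ℝ → ℝ := fun s t => meanAction (π / 2 * (t - s)) (D s t) with hc
  have hsub : ∀ x y z, 0 ≤ x → x < y → y < z → z ≤ 1 → c x z ≤ c x y + c y z := by
    intro x y z hx hxy hyz hz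
    have := meanAction_W2sqE_subadd (hperm x ⟨hx, by linarith⟩)
      (hperm y ⟨by linarith, by linarith⟩) (hperm z ⟨by linarith, hz⟩)
      (p := π / 2 * (y - x)) (q := π / 2 * (z - y)) (by have := sub_pos.2 hxy; positivity)
      (by have := sub_pos.2 hyz; positivity) (by nlinarith)
    rwa [← mul_add, sub_add_sub_cancel'] at this
  refine le_of_forall_pos_le_add fun ε hε => ?_
  set h : ℝ := min (1 / 2) (ε / 3) with hh
  have hh0 : 0 < h := by positivity
  have hh1 : h ≤ 1 / 2 := min_le_left _ _
  have hh2 : h ≤ ε / 3 := min_le_right _ _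
  have hpos : 0 < 1 - h ^ 2 := by nlinarith
  have hloc : ∀ x y, 0 ≤ x → x < y → y ≤ 1 → y - x ≤ h →
      c x y ≤ 2 / (π * (1 - h ^ 2)) * (D x y / (y - x)) - π / 3 * (y - x) :=
    fun x y _ hxy _ hle =>
      meanAction_le_of_le (sub_pos.2 hxy) hle (by linarith) (W2sqE_nonneg _ _)
  obtain ⟨S₁, hS₁⟩ := exists_isEnergySum D hh0 hs
  obtain ⟨S₂, hS₂⟩ := exists_isEnergySum D hh0 hst
  obtain ⟨S₃, hS₃⟩ := exists_isEnergySum D hh0 ht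
  have hS : S₁ + S₂ + S₃ ≤ π ^ 2 / 6 := by
    obtain ⟨k, u, hk, u0, uk, hu, e⟩ := (hS₁.trans hS₂).trans hS₃
    have : ENNReal.ofReal (S₁ + S₂ + S₃) ≤ ENNReal.ofReal (π ^ 2 / 6) := by
      refine le_trans ?_ henergy
      rw [e]
      exact le_iSup₂_of_le k u (le_iSup_of_le ⟨hk, u0, uk, fun i hi => (hu i hi).1⟩ le_rfl)
    exact (ENNReal.ofReal_le_ofReal_iff (by positivity)).1 this
  have b1 := hS₁.subadd_le hsub hloc le_rfl (by linarith)
  have b2 := hS₂.subadd_le hsub hloc hs.le (by linarith)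
  have b3 := hS₃.subadd_le hsub hloc (by linarith) le_rfl
  have b4 : 2 / (π * (1 - h ^ 2)) * (S₁ + S₂ + S₃) ≤ π / 3 + ε := by
    calc 2 / (π * (1 - h ^ 2)) * (S₁ + S₂ + S₃)
        ≤ 2 / (π * (1 - h ^ 2)) * (π ^ 2 / 6) := by gcongr
      _ = π / 3 / (1 - h ^ 2) := by field_simp; norm_num
      _ ≤ π / 3 + ε := by
        rw [div_le_iff₀ hpos]
        have := Real.pi_le_four
        nlinarith
  simp only [hc, sub_zero] at b1 b2 b3
  linarith

/-- The density of the Archimedean measure. -/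
noncomputable def archDensity (p : ℝ × ℝ) : ℝ≥0∞ :=
  ENNReal.ofReal
    (if p.1 ^ 2 + p.2 ^ 2 < 1 then (2 * π * Real.sqrt (1 - p.1 ^ 2 - p.2 ^ 2))⁻¹ else 0)

lemma measurable_archDensity : Measurable archDensity := by
  unfold archDensity
  refine ENNReal.measurable_ofReal.comp (Measurable.ite ?_ (by fun_prop) measurable_const)
  exact measurableSet_lt (by fun_prop) measurable_const

lemma lintegral_archDensity (x : ℝ) :
    ∫⁻ y, archDensity (x, y) = (Ioo (-1 : ℝ) 1).indicator (fun _ => (2 : ℝ≥0∞)⁻¹) x := by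
  by_cases hx : x ∈ Ioo (-1 : ℝ) 1
  · rw [indicator_of_mem hx]
    have hr2 : 0 < 1 - x ^ 2 := by nlinarith [hx.1, hx.2]
    set r : ℝ := √(1 - x ^ 2) with hr
    have hr0 : 0 < r := Real.sqrt_pos.2 hr2
    have hsq : r ^ 2 = 1 - x ^ 2 := Real.sq_sqrt hr2.le
    have himg : (fun θ => r * Real.sin θ) '' Ioo (-(π / 2)) (π / 2) =
        {y | x ^ 2 + y ^ 2 < 1} := by
      ext y
      simp only [mem_image, mem_ofPred_eq]
      constructor
      · rintro ⟨θ, hθ, rfl⟩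
        have hc := Real.cos_pos_of_mem_Ioo hθ
        have := Real.sin_sq_add_cos_sq θ
        have : Real.sin θ ^ 2 < 1 := by nlinarith
        nlinarith
      · intro hy
        have hlt : |y| < r := abs_lt_of_sq_lt_sq (by linarith) hr0.le
        obtain ⟨h1, h2⟩ := abs_lt.1 hlt
        have h3 : -1 < y / r := by rw [lt_div_iff₀ hr0]; linarith
        have h4 : y / r < 1 := by rw [div_lt_iff₀ hr0]; linarith
        refine ⟨Real.arcsin (y / r),
          ⟨Real.neg_pi_div_two_lt_arcsin.2 h3, Real.arcsin_lt_pi_div_two.2 h4⟩, ?_⟩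
        rw [Real.sin_arcsin h3.le h4.le]
        field_simp
    have hmeas : MeasurableSet {y : ℝ | x ^ 2 + y ^ 2 < 1} :=
      measurableSet_lt (by fun_prop) measurable_const
    have hinj : InjOn (fun θ => r * Real.sin θ) (Ioo (-(π / 2)) (π / 2)) := by
      intro a ha b hb hab
      exact Real.injOn_sin (Ioo_subset_Icc_self ha) (Ioo_subset_Icc_self hb)
        (mul_left_cancel₀ hr0.ne' hab)
    have hder : ∀ θ ∈ Ioo (-(π / 2)) (π / 2), HasDerivWithinAt (fun θ => r * Real.sin θ)
        (r * Real.cos θ) (Ioo (-(π / 2)) (π / 2)) θ :=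
      fun θ _ => ((Real.hasDerivAt_sin θ).const_mul r).hasDerivWithinAt
    calc ∫⁻ y, archDensity (x, y)
        = ∫⁻ y in {y | x ^ 2 + y ^ 2 < 1}, archDensity (x, y) := by
          rw [← lintegral_indicator hmeas]
          refine lintegral_congr fun y => ?_
          by_cases hy : x ^ 2 + y ^ 2 < 1 <;> simp [archDensity, hy]
      _ = ∫⁻ θ in Ioo (-(π / 2)) (π / 2),
          ENNReal.ofReal |r * Real.cos θ| * archDensity (x, r * Real.sin θ) := by
          rw [← himg, lintegral_image_eq_lintegral_abs_deriv_mul measurableSet_Ioo hder hinj]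
      _ = ∫⁻ _ in Ioo (-(π / 2)) (π / 2), ENNReal.ofReal (2 * π)⁻¹ := by
          refine setLIntegral_congr_fun measurableSet_Ioo fun θ hθ => ?_
          have hc := Real.cos_pos_of_mem_Ioo hθ
          have hin : x ^ 2 + (r * Real.sin θ) ^ 2 < 1 := by
            have : r * Real.sin θ ∈ {y | x ^ 2 + y ^ 2 < 1} := himg ▸ mem_image_of_mem _ hθ
            exact this
          have hroot : √(1 - x ^ 2 - (r * Real.sin θ) ^ 2) = r * Real.cos θ := by
            rw [Real.sqrt_eq_iff_mul_self_eq_of_pos (by positivity), ← hsq]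
            linear_combination r ^ 2 * Real.sin_sq_add_cos_sq θ
          simp only [archDensity, if_pos hin, hroot]
          rw [← ENNReal.ofReal_mul (abs_nonneg _), abs_of_pos (by positivity)]
          congr 1
          field_simp
      _ = 2⁻¹ := by
          rw [setLIntegral_const, Real.volume_Ioo, ← ENNReal.ofReal_mul (by positivity)]
          rw [show (2 * π)⁻¹ * (π / 2 - -(π / 2)) = 2⁻¹ by field_simp; norm_num]
          rw [ENNReal.ofReal_inv_of_pos (by norm_num), ENNReal.ofReal_ofNat]
  · rw [indicator_of_notMem hx]
    have : ∀ y, archDensity (x, y) = 0 := by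
      intro y
      have : ¬ x ^ 2 + y ^ 2 < 1 := by
        intro h
        exact hx (abs_lt.1 ((sq_lt_one_iff_abs_lt_one x).1 (by nlinarith [sq_nonneg y])))
      simp [archDensity, this]
    simp [this]

lemma archMeasure_map_fst : archMeasure.map Prod.fst = unif := by
  ext s hs
  rw [Measure.map_apply measurable_fst hs, archMeasure,
    withDensity_apply _ (measurable_fst hs), ← prod_univ, Measure.volume_eq_prod,
    ← Measure.prod_restrict, Measure.restrict_univ]
  change ∫⁻ p, archDensity p ∂_ = _
  rw [lintegral_prod _ measurable_archDensity.aemeasurable]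
  simp_rw [lintegral_archDensity]
  rw [lintegral_indicator_const measurableSet_Ioo, unif, Measure.smul_apply, smul_eq_mul,
    Measure.restrict_apply measurableSet_Ioo, ← restrict_Ioo_eq_restrict_Icc,
    Measure.restrict_apply hs, inter_comm]

instance : IsProbabilityMeasure archMeasure := by
  have : IsProbabilityMeasure (archMeasure.map Prod.fst) := archMeasure_map_fst ▸ inferInstance
  exact Measure.isProbabilityMeasure_of_map Prod.fst

lemma volume_preserving_planeRotation (θ : ℝ) :
    MeasurePreserving (fun p : ℝ × ℝ => (Real.cos θ * p.1 + Real.sin θ * p.2,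
      -Real.sin θ * p.1 + Real.cos θ * p.2)) := by
  have h := (Complex.volume_preserving_equiv_real_prod.comp
    (rotation (Circle.exp (-θ))).measurePreserving).comp
      Complex.volume_preserving_equiv_real_prod.symm
  convert h using 1
  ext p
  · change _ = (((Circle.exp (-θ) : Circle) : ℂ) * ⟨p.1, p.2⟩).re
    rw [Circle.coe_exp]
    simp [Complex.exp_re, Complex.exp_im]
  · change _ = (((Circle.exp (-θ) : Circle) : ℂ) * ⟨p.1, p.2⟩).im
    rw [Circle.coe_exp]
    simp [Complex.exp_re, Complex.exp_im, add_comm]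

lemma archMeasure_map_planeRotation (θ : ℝ) :
    archMeasure.map (fun p : ℝ × ℝ => (Real.cos θ * p.1 + Real.sin θ * p.2,
      -Real.sin θ * p.1 + Real.cos θ * p.2)) = archMeasure := by
  have h := volume_preserving_planeRotation θ
  ext s hs
  rw [Measure.map_apply h.measurable hs, archMeasure, withDensity_apply _ (h.measurable hs),
    withDensity_apply _ hs]
  change ∫⁻ p in _, archDensity p = ∫⁻ p in _, archDensity p
  rw [← h.setLIntegral_comp_preimage hs measurable_archDensity]
  refine lintegral_congr fun p => ?_
  have e : (Real.cos θ * p.1 + Real.sin θ * p.2) ^ 2 +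
      (-Real.sin θ * p.1 + Real.cos θ * p.2) ^ 2 = p.1 ^ 2 + p.2 ^ 2 := by
    linear_combination (p.1 ^ 2 + p.2 ^ 2) * Real.sin_sq_add_cos_sq θ
  simp only [archDensity, sub_sub, e]

/-- The characteristic function of a measure on the plane. -/
noncomputable def planeCharFun (ν : Measure (ℝ × ℝ)) (u v : ℝ) : ℂ :=
  ∫ p, Complex.exp ((u * p.1 + v * p.2 : ℝ) * Complex.I) ∂ν

lemma planeCharFun_ext {μ ν : Measure (ℝ × ℝ)} [IsFiniteMeasure μ] [IsFiniteMeasure ν]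
    (h : ∀ u v, planeCharFun μ u v = planeCharFun ν u v) : μ = ν := by
  refine Measure.ext_of_charFunDual (funext fun L => ?_)
  have hL (p : ℝ × ℝ) : L p = L (1, 0) * p.1 + L (0, 1) * p.2 := by
    obtain ⟨x, y⟩ := p
    have : ((x, y) : ℝ × ℝ) = x • (1, 0) + y • (0, 1) := by simp
    rw [this, map_add, map_smul, map_smul]
    simp [mul_comm]
  rw [charFunDual_apply, charFunDual_apply]
  convert h (L (1, 0)) (L (0, 1)) using 1
  all_goals exact integral_congr_ae (ae_of_all _ fun p => by simp only [hL p])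

lemma planeCharFun_map {Ω : Type*} [MeasurableSpace Ω] {ρ : Measure Ω} {V : Ω → ℝ × ℝ}
    (hV : Measurable V) (u v : ℝ) : planeCharFun (ρ.map V) u v =
      ∫ ω, Complex.exp ((u * (V ω).1 + v * (V ω).2 : ℝ) * Complex.I) ∂ρ := by
  rw [planeCharFun, integral_map hV.aemeasurable (by fun_prop)]

lemma planeCharFun_of_map_fst {ν : Measure (ℝ × ℝ)} (h : ν.map Prod.fst = unif) (r : ℝ) :
    planeCharFun ν r 0 = ∫ x, Complex.exp ((r * x : ℝ) * Complex.I) ∂unif := by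
  rw [← h, integral_map (by fun_prop) (by fun_prop)]
  simp [planeCharFun]

lemma planeCharFun_of_map_snd {ν : Measure (ℝ × ℝ)} (h : ν.map Prod.snd = unif) (r : ℝ) :
    planeCharFun ν 0 r = ∫ x, Complex.exp ((r * x : ℝ) * Complex.I) ∂unif := by
  rw [← h, integral_map (by fun_prop) (by fun_prop)]
  simp [planeCharFun]

lemma exists_polar_of_sq_add_sq_eq {a b r : ℝ} (h : a ^ 2 + b ^ 2 = r ^ 2) :
    ∃ θ, a = r * Real.cos θ ∧ b = r * Real.sin θ := by
  rcases eq_or_ne r 0 with rfl | hr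
  · exact ⟨0, by nlinarith [sq_nonneg a, sq_nonneg b], by nlinarith [sq_nonneg a, sq_nonneg b]⟩
  · have hz : ‖(⟨a / r, b / r⟩ : ℂ)‖ = 1 := by
      rw [← sq_eq_sq₀ (norm_nonneg _) zero_le_one, Complex.sq_norm, Complex.normSq_mk]
      field_simp
      linarith
    have hz0 : (⟨a / r, b / r⟩ : ℂ) ≠ 0 := by
      intro h0
      simp [h0] at hz
    refine ⟨Complex.arg ⟨a / r, b / r⟩, ?_, ?_⟩
    · rw [Complex.cos_arg hz0, hz]; field_simp
    · rw [Complex.sin_arg, hz]; field_simp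

lemma planeCharFun_archMeasure {a b r : ℝ} (h : a ^ 2 + b ^ 2 = r ^ 2) :
    planeCharFun archMeasure a b = ∫ x, Complex.exp ((r * x : ℝ) * Complex.I) ∂unif := by
  obtain ⟨θ, rfl, rfl⟩ := exists_polar_of_sq_add_sq_eq h
  rw [← planeCharFun_of_map_fst archMeasure_map_fst]
  conv_rhs => rw [← archMeasure_map_planeRotation θ, planeCharFun_map (by fun_prop)]
  rw [planeCharFun]
  congr! 5 with p
  ring

lemma planeCharFun_archPath {t u v r : ℝ}
    (h : u ^ 2 + v ^ 2 + 2 * u * v * Real.cos (π * t) = r ^ 2) :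
    planeCharFun (archPath t) u v = ∫ x, Complex.exp ((r * x : ℝ) * Complex.I) ∂unif := by
  rw [archPath, planeCharFun_map (by fun_prop), ← planeCharFun_archMeasure
    (a := u + v * Real.cos (π * t)) (b := v * Real.sin (π * t)), planeCharFun]
  · congr! 5 with p
    ring
  · linear_combination h + v ^ 2 * Real.sin_sq_add_cos_sq (π * t)

lemma exists_quadrant_polar (a b : ℝ) : ∃ τ ∈ Icc (0 : ℝ) 1, ∃ r, a = r * Real.cos (π / 2 * τ) ∧
    (b = r * Real.sin (π / 2 * τ) ∨ b = -(r * Real.sin (π / 2 * τ))) := by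
  have hπ := Real.pi_pos
  set z : ℂ := ⟨|a|, |b|⟩ with hz
  have h0 : 0 ≤ z.arg := Complex.arg_nonneg_iff.2 (abs_nonneg b)
  have h1 : z.arg ≤ π / 2 :=
    (le_abs_self _).trans (Complex.abs_arg_le_pi_div_two_iff.2 (abs_nonneg a))
  have e : π / 2 * (z.arg / (π / 2)) = z.arg := by field_simp
  have ea : |a| = ‖z‖ * Real.cos z.arg := (Complex.norm_mul_cos_arg z).symm
  have eb : |b| = ‖z‖ * Real.sin z.arg := (Complex.norm_mul_sin_arg z).symm
  refine ⟨z.arg / (π / 2), ⟨by positivity, (div_le_one (by positivity)).2 h1⟩, ?_⟩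
  rw [e]
  rcases abs_choice a with ha | ha <;> rcases abs_choice b with hb | hb
  · exact ⟨‖z‖, by linarith, .inl (by linarith)⟩
  · exact ⟨‖z‖, by linarith, .inr (by linarith)⟩
  · exact ⟨-‖z‖, by linarith, .inr (by linarith)⟩
  · exact ⟨-‖z‖, by linarith, .inl (by linarith)⟩

lemma norm_exp_mul_I_sub_le (x y : ℝ) :
    ‖Complex.exp (x * Complex.I) - Complex.exp (y * Complex.I)‖ ≤ |x - y| := by
  have e : Complex.exp (x * Complex.I) - Complex.exp (y * Complex.I) =
      Complex.exp (y * Complex.I) * (Complex.exp (Complex.I * (x - y : ℝ)) - 1) := by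
    rw [mul_sub, ← Complex.exp_add]
    push_cast
    ring_nf
  rw [e, norm_mul, Complex.norm_exp_ofReal_mul_I, one_mul]
  exact Real.norm_exp_I_mul_ofReal_sub_one_le

lemma norm_planeCharFun_map_sub_le {Ω : Type*} [MeasurableSpace Ω] {ρ : Measure Ω}
    [IsProbabilityMeasure ρ] {V W : Ω → ℝ × ℝ} (hV : Measurable V) (hW : Measurable W)
    (hi : Integrable (fun ω => sqDist (V ω) (W ω)) ρ) {ε : ℝ} (hε : 0 < ε)
    (h : ∫ ω, sqDist (V ω) (W ω) ∂ρ ≤ ε ^ 2) (u v : ℝ) :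
    ‖planeCharFun (ρ.map V) u v - planeCharFun (ρ.map W) u v‖ ≤ (|u| + |v|) * ε := by
  have hint {U : Ω → ℝ × ℝ} (hU : Measurable U) :
      Integrable (fun ω => Complex.exp ((u * (U ω).1 + v * (U ω).2 : ℝ) * Complex.I)) ρ :=
    Integrable.of_bound (by fun_prop) 1
      (ae_of_all _ fun ω => (Complex.norm_exp_ofReal_mul_I _).le)
  rw [planeCharFun_map hV, planeCharFun_map hW, ← integral_sub (hint hV) (hint hW)]
  have hg : Integrable (fun ω => (|u| + |v|) * ((ε ^ 2 + sqDist (V ω) (W ω)) / (2 * ε))) ρ :=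
    (((integrable_const _).add hi).div_const _).const_mul _
  refine (norm_integral_le_of_norm_le hg (ae_of_all _ fun ω => ?_)).trans ?_
  · refine (norm_exp_mul_I_sub_le _ _).trans ?_
    have amgm (d e : ℝ) : |d| ≤ (ε ^ 2 + (d ^ 2 + e ^ 2)) / (2 * ε) := by
      rw [le_div_iff₀ (by positivity), ← sq_abs d]
      nlinarith [sq_nonneg (|d| - ε), sq_nonneg e]
    have h1 := amgm ((V ω).1 - (W ω).1) ((V ω).2 - (W ω).2)
    have h2 := amgm ((V ω).2 - (W ω).2) ((V ω).1 - (W ω).1)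
    rw [add_comm (((V ω).2 - (W ω).2) ^ 2)] at h2
    calc |u * (V ω).1 + v * (V ω).2 - (u * (W ω).1 + v * (W ω).2)|
        = |u * ((V ω).1 - (W ω).1) + v * ((V ω).2 - (W ω).2)| := by congr 1; ring
      _ ≤ |u| * |(V ω).1 - (W ω).1| + |v| * |(V ω).2 - (W ω).2| := by
        rw [← abs_mul, ← abs_mul]; exact abs_add_le _ _
      _ ≤ _ := by
        rw [add_mul, sqDist]
        gcongr
  · rw [integral_const_mul, integral_div, integral_add (integrable_const _) hi]
    simp only [integral_const, probReal_univ, one_smul]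
    gcongr
    rw [div_le_iff₀ (by positivity)]
    nlinarith

lemma ae_idPermuton : ∀ᵐ p ∂idPermuton, p.2 = p.1 := by
  rw [idPermuton, ae_map_iff (by fun_prop) (measurableSet_eq_fun (by fun_prop) (by fun_prop))]
  exact ae_of_all _ fun _ => rfl

lemma ae_revPermuton : ∀ᵐ p ∂revPermuton, p.2 = -p.1 := by
  rw [revPermuton, ae_map_iff (by fun_prop) (measurableSet_eq_fun (by fun_prop) (by fun_prop))]
  exact ae_of_all _ fun _ => rfl

lemma sqDist_oscInterp_le {p q : ℝ} (hp : 0 < p) (hq : 0 < q) (hpq : p + q = π / 2)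
    (x y z : ℝ × ℝ) : sqDist y (oscInterp p q x z) ≤
      oscAction p x y + oscAction q y z - oscAction (π / 2) x z := by
  have h1 := sin_pos_of_pos_of_le_pi_div_two hp (by linarith)
  have h2 := sin_pos_of_pos_of_le_pi_div_two hq (by linarith)
  rw [oscAction_add hp hq hpq.le, hpq, Real.sin_pi_div_two, add_sub_cancel_left]
  refine le_mul_of_one_le_left (sqDist_nonneg _ _) ((one_le_div (by positivity)).2 ?_)
  exact mul_le_one₀ (Real.sin_le_one p) h2.le (Real.sin_le_one q)

/-- The position at time `τ` of the oscillator which moves from `(a, a)` to `(b, -b)` during the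
unit time interval, with `p = (a, b)`. -/
noncomputable def archFlow (τ : ℝ) (p : ℝ × ℝ) : ℝ × ℝ :=
  (Real.cos (π / 2 * τ) * p.1 + Real.sin (π / 2 * τ) * p.2,
    Real.cos (π / 2 * τ) * p.1 - Real.sin (π / 2 * τ) * p.2)

lemma measurable_archFlow (τ : ℝ) : Measurable (archFlow τ) := by
  unfold archFlow
  fun_prop

lemma planeCharFun_map_archFlow (ν : Measure (ℝ × ℝ)) (τ u v : ℝ) :
    planeCharFun (ν.map (archFlow τ)) u v = planeCharFun ν
      ((u + v) * Real.cos (π / 2 * τ)) ((u - v) * Real.sin (π / 2 * τ)) := by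
  rw [planeCharFun_map (measurable_archFlow τ), planeCharFun]
  congr! 5 with p
  simp only [archFlow]
  ring

lemma oscInterp_eq_archFlow {x z : ℝ × ℝ} (hx : x.2 = x.1) (hz : z.2 = -z.1) (τ : ℝ) :
    oscInterp (π / 2 * τ) (π / 2 * (1 - τ)) x z = archFlow τ (x.1, z.1) := by
  have h : π / 2 * τ + π / 2 * (1 - τ) = π / 2 := by ring
  have h' : π / 2 * (1 - τ) = π / 2 - π / 2 * τ := by ring
  rw [oscInterp, h, h', Real.sin_pi_div_two, Real.sin_pi_div_two_sub, hx, hz, archFlow]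
  ext <;> simp [sub_eq_add_neg]

lemma oscAction_pi_div_two_eq_zero {x z : ℝ × ℝ} (hx : x.2 = x.1) (hz : z.2 = -z.1) :
    oscAction (π / 2) x z = 0 := by
  rw [oscAction, Real.cos_pi_div_two, Real.sin_pi_div_two, sqDist, hx, hz]
  ring

lemma exists_archFlow_approx {μ : ℝ → Measure (ℝ × ℝ)}
    (hperm : ∀ t ∈ Icc (0 : ℝ) 1, IsPermuton (μ t))
    (h0 : μ 0 = idPermuton) (h1 : μ 1 = revPermuton)
    (henergy : energyOf (fun s t => W2sqE (μ s) (μ t)) ≤ ENNReal.ofReal (π ^ 2 / 6))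
    {s t : ℝ} (hs : 0 < s) (hst : s < t) (ht : t < 1) {ε : ℝ} (hε : 0 < ε) :
    ∃ ν : Measure (ℝ × ℝ), ∀ τ, τ = 0 ∨ τ = s ∨ τ = t ∨ τ = 1 → ∀ u v,
      ‖planeCharFun (μ τ) u v - planeCharFun (ν.map (archFlow τ)) u v‖ ≤ (|u| + |v|) * ε := by
  have hπ := Real.pi_pos
  have P0 := hperm 0 ⟨le_rfl, zero_le_one⟩
  have Ps := hperm s ⟨hs.le, by linarith⟩
  have Pt := hperm t ⟨by linarith, ht.le⟩
  have P1 := hperm 1 ⟨zero_le_one, le_rfl⟩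
  have hp : 0 < π / 2 * s := by positivity
  have hq : 0 < π / 2 * (t - s) := by have := sub_pos.2 hst; positivity
  have hr : 0 < π / 2 * (1 - t) := by have := sub_pos.2 ht; positivity
  have hp' : 0 < π / 2 * t := by have := hs.trans hst; positivity
  have hr' : 0 < π / 2 * (1 - s) := by have := sub_pos.2 (hst.trans ht); positivity
  have hδ : 0 < ε ^ 2 / 3 := by positivity
  obtain ⟨m₁, _, a1, a2, c1⟩ := exists_coupling_meanAction_le P0 Ps hp (by nlinarith) hδ
  obtain ⟨m₂, _, a3, a4, c2⟩ := exists_coupling_meanAction_le Ps Pt hq (by nlinarith) hδ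
  obtain ⟨m₃, _, a5, a6, c3⟩ := exists_coupling_meanAction_le Pt P1 hr (by nlinarith) hδ
  obtain ⟨n, _, b1, b2⟩ := exists_glue m₁ m₂ (a2.trans a3.symm)
  have nt : n.map Prod.snd = μ t := by
    rw [← a4, ← b2, Measure.map_map (by fun_prop) (by fun_prop)]; rfl
  obtain ⟨m, _, b3, b4⟩ := exists_glue n m₃ (nt.trans a5.symm)
  let V0 : (((ℝ × ℝ) × ℝ × ℝ) × ℝ × ℝ) × ℝ × ℝ → ℝ × ℝ := fun ω => ω.1.1.1
  let Vs : (((ℝ × ℝ) × ℝ × ℝ) × ℝ × ℝ) × ℝ × ℝ → ℝ × ℝ := fun ω => ω.1.1.2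
  let Vt : (((ℝ × ℝ) × ℝ × ℝ) × ℝ × ℝ) × ℝ × ℝ → ℝ × ℝ := fun ω => ω.1.2
  let V1 : (((ℝ × ℝ) × ℝ × ℝ) × ℝ × ℝ) × ℝ × ℝ → ℝ × ℝ := fun ω => ω.2
  have m0 : Measurable V0 := by fun_prop
  have ms : Measurable Vs := by fun_prop
  have mt : Measurable Vt := by fun_prop
  have m1 : Measurable V1 := by fun_prop
  have j1 : m.map (fun ω => (V0 ω, Vs ω)) = m₁ := by
    rw [← b1, ← b3, Measure.map_map (by fun_prop) (by fun_prop)]; rfl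
  have j2 : m.map (fun ω => (Vs ω, Vt ω)) = m₂ := by
    rw [← b2, ← b3, Measure.map_map (by fun_prop) (by fun_prop)]; rfl
  have j3 : m.map (fun ω => (Vt ω, V1 ω)) = m₃ := b4
  have l0 : m.map V0 = μ 0 := by
    rw [← a1, ← j1, Measure.map_map (by fun_prop) (by fun_prop)]; rfl
  have ls : m.map Vs = μ s := by
    rw [← a2, ← j1, Measure.map_map (by fun_prop) (by fun_prop)]; rfl
  have lt : m.map Vt = μ t := by
    rw [← a4, ← j2, Measure.map_map (by fun_prop) (by fun_prop)]; rfl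
  have l1 : m.map V1 = μ 1 := by
    rw [← a6, ← j3, Measure.map_map (by fun_prop) (by fun_prop)]; rfl
  have r0 : IsPermRV V0 m := .of_map m0 (l0 ▸ P0)
  have rs : IsPermRV Vs m := .of_map ms (ls ▸ Ps)
  have rt : IsPermRV Vt m := .of_map mt (lt ▸ Pt)
  have r1 : IsPermRV V1 m := .of_map m1 (l1 ▸ P1)
  have d0 : ∀ᵐ ω ∂m, (V0 ω).2 = (V0 ω).1 :=
    ae_of_ae_map m0.aemeasurable (by rw [l0, h0]; exact ae_idPermuton)
  have d1 : ∀ᵐ ω ∂m, (V1 ω).2 = -(V1 ω).1 :=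
    ae_of_ae_map m1.aemeasurable (by rw [l1, h1]; exact ae_revPermuton)
  rw [← j1, integral_map (by fun_prop) measurable_sqDist.aestronglyMeasurable,
    ← r0.integral_oscAction rs] at c1
  rw [← j2, integral_map (by fun_prop) measurable_sqDist.aestronglyMeasurable,
    ← rs.integral_oscAction rt] at c2
  rw [← j3, integral_map (by fun_prop) measurable_sqDist.aestronglyMeasurable,
    ← rt.integral_oscAction r1] at c3
  have i1 := r0.integrable_oscAction rs (π / 2 * s)
  have i2 := rs.integrable_oscAction rt (π / 2 * (t - s))
  have i3 := rt.integrable_oscAction r1 (π / 2 * (1 - t))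
  have itot := (i1.add i2).add i3
  have htot : ∫ ω, (oscAction (π / 2 * s) (V0 ω) (Vs ω) +
      oscAction (π / 2 * (t - s)) (Vs ω) (Vt ω) + oscAction (π / 2 * (1 - t)) (Vt ω) (V1 ω)) ∂m ≤
        ε ^ 2 := by
    have e := integral_add (i1.add i2) i3
    simp only [Pi.add_apply] at e
    rw [e, integral_add i1 i2]
    linarith [sum_meanAction_nonpos hperm henergy hs hst ht]
  have mB : Measurable fun ω => ((V0 ω).1, (V1 ω).1) := by fun_prop
  -- A dominated mean squared distance to the flow controls the characteristic function.
  have close {τ : ℝ} {V : (((ℝ × ℝ) × ℝ × ℝ) × ℝ × ℝ) × ℝ × ℝ → ℝ × ℝ} (hV : Measurable V)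
      (hτ : m.map V = μ τ) {g : (((ℝ × ℝ) × ℝ × ℝ) × ℝ × ℝ) × ℝ × ℝ → ℝ} (hg : Integrable g m)
      (hle : ∀ᵐ ω ∂m, sqDist (V ω) (archFlow τ ((V0 ω).1, (V1 ω).1)) ≤ g ω)
      (hgε : ∫ ω, g ω ∂m ≤ ε ^ 2) (u v : ℝ) :
      ‖planeCharFun (μ τ) u v - planeCharFun ((m.map fun ω => ((V0 ω).1, (V1 ω).1)).map
        (archFlow τ)) u v‖ ≤ (|u| + |v|) * ε := by
    rw [← hτ, Measure.map_map (measurable_archFlow τ) mB]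
    have hW := (measurable_archFlow τ).comp mB
    have hi : Integrable (fun ω => sqDist (V ω) (archFlow τ ((V0 ω).1, (V1 ω).1))) m := by
      refine hg.mono' (measurable_sqDist.comp (hV.prodMk hW)).aestronglyMeasurable ?_
      filter_upwards [hle] with ω hω
      rwa [Real.norm_of_nonneg (sqDist_nonneg _ _)]
    exact norm_planeCharFun_map_sub_le hV hW hi hε ((integral_mono_ae hi hg hle).trans hgε) u v
  refine ⟨m.map fun ω => ((V0 ω).1, (V1 ω).1), ?_⟩
  rintro τ (rfl | rfl | rfl | rfl)
  · refine close m0 l0 (integrable_zero _ _ _) ?_ (by simp; positivity)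
    filter_upwards [d0] with ω e0
    simp [sqDist, archFlow, e0]
  · refine close ms ls itot ?_ htot
    filter_upwards [d0, d1] with ω e0 e1
    have b := sqDist_oscInterp_le hp hr' (by ring) (V0 ω) (Vs ω) (V1 ω)
    have b' := oscAction_subadd hq hr (by nlinarith) (Vs ω) (Vt ω) (V1 ω)
    rw [oscInterp_eq_archFlow e0 e1, oscAction_pi_div_two_eq_zero e0 e1] at b
    rw [← mul_add, sub_add_sub_cancel'] at b'
    simp only [Pi.add_apply]
    linarith
  · refine close mt lt itot ?_ htot
    filter_upwards [d0, d1] with ω e0 e1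
    have b := sqDist_oscInterp_le hp' hr (by ring) (V0 ω) (Vt ω) (V1 ω)
    have b' := oscAction_subadd hp hq (by nlinarith) (V0 ω) (Vs ω) (Vt ω)
    rw [oscInterp_eq_archFlow e0 e1, oscAction_pi_div_two_eq_zero e0 e1] at b
    rw [← mul_add, add_sub_cancel] at b'
    simp only [Pi.add_apply]
    linarith
  · refine close m1 l1 (integrable_zero _ _ _) ?_ (by simp; positivity)
    filter_upwards [d1] with ω e1
    simp [sqDist, archFlow, e1]

lemma exists_ordered_pair_covering {s t : ℝ} (hs : s ∈ Icc (0 : ℝ) 1) (ht : t ∈ Icc (0 : ℝ) 1) :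
    ∃ a b : ℝ, 0 < a ∧ a < b ∧ b < 1 ∧ (s = 0 ∨ s = a ∨ s = b ∨ s = 1) ∧
      (t = 0 ∨ t = a ∨ t = b ∨ t = 1) := by
  have one {x : ℝ} (hx : x ∈ Icc (0 : ℝ) 1) : ∃ a b : ℝ, 0 < a ∧ a < b ∧ b < 1 ∧
      (x = 0 ∨ x = a ∨ x = 1) := by
    by_cases h : 0 < x ∧ x < 1
    · exact ⟨x, (x + 1) / 2, by linarith, by linarith, by linarith, by simp⟩
    · refine ⟨1 / 3, 1 / 2, by norm_num, by norm_num, by norm_num, ?_⟩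
      rcases hx.1.eq_or_lt with h' | h'
      · exact .inl h'.symm
      · exact .inr (.inr (hx.2.antisymm (not_lt.1 fun h'' => h ⟨h', h''⟩)))
  rcases hs.1.eq_or_lt with rfl | s0
  · obtain ⟨a, b, h⟩ := one ht; exact ⟨a, b, by tauto⟩
  rcases hs.2.eq_or_lt with rfl | s1
  · obtain ⟨a, b, h⟩ := one ht; exact ⟨a, b, by tauto⟩
  rcases ht.1.eq_or_lt with rfl | t0
  · obtain ⟨a, b, h⟩ := one hs; exact ⟨a, b, by tauto⟩
  rcases ht.2.eq_or_lt with rfl | t1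
  · obtain ⟨a, b, h⟩ := one hs; exact ⟨a, b, by tauto⟩
  rcases lt_trichotomy s t with h | rfl | h
  · exact ⟨s, t, by tauto⟩
  · obtain ⟨a, b, h⟩ := one hs; exact ⟨a, b, by tauto⟩
  · exact ⟨t, s, by tauto⟩

/-- a permuton-valued path from the identity permuton to the reverse permuton
whose 2-Wasserstein energy equals π²/6 coincides with the Archimedean path. -/
theorem permuton_path_energy_eq_implies_archimedean
    (μ : ℝ → Measure (ℝ × ℝ))
    (hperm : ∀ t ∈ Icc (0:ℝ) 1, IsPermuton (μ t))
    (h0 : μ 0 = idPermuton) (h1 : μ 1 = revPermuton)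
    (henergy : energyOf (fun s t => W2sqE (μ s) (μ t)) = ENNReal.ofReal (π ^ 2 / 6)) :
    ∀ t ∈ Icc (0:ℝ) 1, μ t = archPath t := by
  intro t ht
  have hper := hperm t ht
  have := hper.1
  have : IsFiniteMeasure (archPath t) := by unfold archPath; infer_instance
  refine planeCharFun_ext fun u v => ?_
  obtain ⟨τ, hτ, r, ha, hb⟩ := exists_quadrant_polar ((u + v) * Real.cos (π / 2 * t))
    ((u - v) * Real.sin (π / 2 * t))
  obtain ⟨u', v', huv, hφ⟩ : ∃ u' v' : ℝ, ((u' + v') * Real.cos (π / 2 * τ) =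
        (u + v) * Real.cos (π / 2 * t) ∧
      (u' - v') * Real.sin (π / 2 * τ) = (u - v) * Real.sin (π / 2 * t)) ∧
      planeCharFun (μ τ) u' v' = ∫ x, Complex.exp ((r * x : ℝ) * Complex.I) ∂unif := by
    rcases hb with hb | hb
    · exact ⟨r, 0, ⟨by linarith, by linarith⟩, planeCharFun_of_map_fst (hperm τ hτ).2.1 r⟩
    · exact ⟨0, r, ⟨by linarith, by linarith⟩, planeCharFun_of_map_snd (hperm τ hτ).2.2 r⟩
  rw [planeCharFun_archPath (r := r), ← hφ]
  · obtain ⟨a, b, ha0, hab, hb1, hτab, htab⟩ := exists_ordered_pair_covering hτ ht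
    rw [← sub_eq_zero, ← norm_le_zero_iff]
    refine le_of_forall_pos_le_add fun ε hε => ?_
    set K := |u| + |v| + (|u'| + |v'|) + 1 with hK
    have hK0 : 0 < K := by positivity
    obtain ⟨ν, hν⟩ :=
      exists_archFlow_approx hperm h0 h1 henergy.le ha0 hab hb1 (div_pos hε hK0)
    have b1 := hν t htab u v
    have b2 := hν τ hτab u' v'
    rw [planeCharFun_map_archFlow] at b1 b2
    rw [huv.1, huv.2, norm_sub_rev] at b2
    have b3 := norm_sub_le_norm_sub_add_norm_sub (planeCharFun (μ t) u v)
      (planeCharFun ν ((u + v) * Real.cos (π / 2 * t)) ((u - v) * Real.sin (π / 2 * t)))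
      (planeCharFun (μ τ) u' v')
    have b4 : K * (ε / K) = ε := by field_simp
    have b5 : 0 < ε / K := by positivity
    rw [hK] at b4 b5 b1 b2
    nlinarith
  · have hb2 : ((u - v) * Real.sin (π / 2 * t)) ^ 2 = (r * Real.sin (π / 2 * τ)) ^ 2 := by
      rcases hb with hb | hb <;> rw [hb] <;> ring
    have e : Real.cos (π * t) = 2 * Real.cos (π / 2 * t) ^ 2 - 1 := by
      rw [← Real.cos_two_mul]
      ring_nf
    rw [e]
    have s1 := Real.sin_sq_add_cos_sq (π / 2 * t)
    have s2 := Real.sin_sq_add_cos_sq (π / 2 * τ)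
    have ha2 : ((u + v) * Real.cos (π / 2 * t)) ^ 2 = (r * Real.cos (π / 2 * τ)) ^ 2 := by rw [ha]
    linear_combination ha2 + hb2 - (u - v) ^ 2 * s1 + r ^ 2 * s2
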